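/- Let d ≥ 1, R > 0, let v ∈ ℝ^d be a unit vector, and let φ : ℝ^d → ℝ be a Lipschitz function vanishing outside B_R. For t ∈ ℝ with |t|·Lip(φ) < 1, the map ψ_t(x) = x + t·φ(x)·v is a bi-Lipschitz bijection of ℝ^d mapping B_R onto B_R. Then for every continuous G : ℝ → ℝ and every continuous bounded u : ℝ^d → ℝ one has the exact identity ∫_{B_R} G(u(ψ_t^{-1}(x))) dx + ∫_{B_R} G(u(ψ_{−t}^{-1}(x))) dx = 2 ∫_{B_R} G(u(x)) dx, i.e., the second domain variation of the potential energy ∫_{B_R} G(u) vanishes. -/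

import Mathlib

open MeasureTheory Metric Set Function
open scoped ENNReal NNReal

section helpers

variable {d : ℕ} {v : EuclideanSpace ℝ (Fin d)} {φ : EuclideanSpace ℝ (Fin d) → ℝ} {K : ℝ≥0}

lemma aux_smul (hv : ‖v‖ = 1) (hφ : LipschitzWith K φ) (t : ℝ)
    (x y : EuclideanSpace ℝ (Fin d)) :
    ‖(t * φ x) • v - (t * φ y) • v‖ ≤ |t| * K * ‖x - y‖ := by
  rw [← sub_smul, norm_smul, hv, mul_one, ← mul_sub, norm_mul, Real.norm_eq_abs, mul_assoc]
  exact mul_le_mul_of_nonneg_left (hφ.norm_sub_le x y) (abs_nonneg t)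

lemma aux_anti (hv : ‖v‖ = 1) (hφ : LipschitzWith K φ) (t : ℝ) (ht : |t| * (K : ℝ) < 1) :
    AntilipschitzWith (Real.toNNReal (1 - |t| * K)⁻¹)
      (fun x : EuclideanSpace ℝ (Fin d) => x + (t * φ x) • v) := by
  have hp : 0 < 1 - |t| * K := by linarith
  apply AntilipschitzWith.of_le_mul_dist
  intro x y
  rw [Real.coe_toNNReal _ (inv_nonneg.2 hp.le), dist_eq_norm, dist_eq_norm, inv_mul_eq_div,
    le_div_iff₀ hp]
  have h1 := aux_smul hv hφ t x y
  have h2 : ‖x - y‖ ≤ ‖x + (t * φ x) • v - (y + (t * φ y) • v)‖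
      + ‖(t * φ x) • v - (t * φ y) • v‖ := by
    have := norm_sub_le (x + (t * φ x) • v - (y + (t * φ y) • v))
      ((t * φ x) • v - (t * φ y) • v)
    refine le_trans (le_of_eq ?_) this
    congr 1
    abel
  nlinarith

lemma aux_lip (hv : ‖v‖ = 1) (hφ : LipschitzWith K φ) (t : ℝ) :
    LipschitzWith (Real.toNNReal (1 + |t| * K))
      (fun x : EuclideanSpace ℝ (Fin d) => x + (t * φ x) • v) := by
  apply LipschitzWith.of_dist_le_mul
  intro x y
  rw [Real.coe_toNNReal _ (by positivity), dist_eq_norm, dist_eq_norm]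
  have h1 := aux_smul hv hφ t x y
  have h2 := norm_add_le (x - y) ((t * φ x) • v - (t * φ y) • v)
  have h3 : x + (t * φ x) • v - (y + (t * φ y) • v)
    = (x - y) + ((t * φ x) • v - (t * φ y) • v) := by abel
  rw [h3]
  nlinarith

lemma aux_surj (hv : ‖v‖ = 1) (hφ : LipschitzWith K φ) (t : ℝ) (ht : |t| * (K : ℝ) < 1) :
    Surjective (fun x : EuclideanSpace ℝ (Fin d) => x + (t * φ x) • v) := by
  intro y
  have hc : ContractingWith (Real.toNNReal (|t| * K)) (fun x => y - (t * φ x) • v) := by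
    refine ⟨by rwa [Real.toNNReal_lt_one], LipschitzWith.of_dist_le_mul fun a b => ?_⟩
    rw [Real.coe_toNNReal _ (by positivity), dist_eq_norm, dist_eq_norm, sub_sub_sub_cancel_left,
      norm_sub_rev]
    exact aux_smul hv hφ t a b
  refine ⟨hc.fixedPoint, ?_⟩
  have h := hc.fixedPoint_isFixedPt
  have h' : y - (t * φ hc.fixedPoint) • v = hc.fixedPoint := h
  exact (sub_eq_iff_eq_add.1 h').symm

lemma aux_bij (hv : ‖v‖ = 1) (hφ : LipschitzWith K φ) (t : ℝ) (ht : |t| * (K : ℝ) < 1) :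
    Bijective (fun x : EuclideanSpace ℝ (Fin d) => x + (t * φ x) • v) :=
  ⟨(aux_anti hv hφ t ht).injective, aux_surj hv hφ t ht⟩

lemma aux_image (hv : ‖v‖ = 1) (hφ : LipschitzWith K φ) {R : ℝ}
    (hφ0 : ∀ x ∉ ball (0 : EuclideanSpace ℝ (Fin d)) R, φ x = 0)
    (t : ℝ) (ht : |t| * (K : ℝ) < 1) :
    (fun x : EuclideanSpace ℝ (Fin d) => x + (t * φ x) • v) ''
        (ball (0 : EuclideanSpace ℝ (Fin d)) R) = ball (0 : EuclideanSpace ℝ (Fin d)) R := by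
  have hout : ∀ x ∉ ball (0 : EuclideanSpace ℝ (Fin d)) R, x + (t * φ x) • v = x := by
    intro x hx
    simp [hφ0 x hx]
  ext y
  constructor
  · rintro ⟨x, hx, rfl⟩
    by_contra hy
    have h1 := (aux_bij hv hφ t ht).1 (hout _ hy)
    exact hy (by rw [h1]; exact hx)
  · intro hy
    obtain ⟨x, rfl⟩ := aux_surj hv hφ t ht y
    refine ⟨x, ?_, rfl⟩
    by_contra hx
    have := hout x hx
    exact hx (by rw [← this]; exact hy)

lemma aux_null {C : ℝ≥0} {f : EuclideanSpace ℝ (Fin d) → EuclideanSpace ℝ (Fin d)}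
    (hf : LipschitzWith C f) {s : Set (EuclideanSpace ℝ (Fin d))} (hs : volume s = 0) :
    volume (f '' s) = 0 := by
  let μ : Measure (EuclideanSpace ℝ (Fin d)) :=
    Measure.hausdorffMeasure (Module.finrank ℝ (EuclideanSpace ℝ (Fin d)) : ℝ)
  have hμ : μ.IsAddHaarMeasure := isAddHaarMeasure_hausdorffMeasure
  have h1 : (volume : Measure (EuclideanSpace ℝ (Fin d))) ≪ μ :=
    Measure.absolutelyContinuous_isAddHaarMeasure _ _
  have h2 : μ ≪ (volume : Measure (EuclideanSpace ℝ (Fin d))) :=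
    Measure.absolutelyContinuous_isAddHaarMeasure _ _
  apply h1
  have h3 := hf.hausdorffMeasure_image_le
    (d := (Module.finrank ℝ (EuclideanSpace ℝ (Fin d)) : ℝ)) (by positivity) s
  have h4 : μ s = 0 := h2 hs
  refine le_antisymm (h3.trans ?_) bot_le
  change _ * μ s ≤ _
  simp [h4]

lemma aux_int (hv : ‖v‖ = 1) (hφ : LipschitzWith K φ) {R : ℝ}
    (hφ0 : ∀ x ∉ ball (0 : EuclideanSpace ℝ (Fin d)) R, φ x = 0)
    (t : ℝ) (ht : |t| * (K : ℝ) < 1) (f : EuclideanSpace ℝ (Fin d) → ℝ) :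
    ∫ x in ball (0 : EuclideanSpace ℝ (Fin d)) R,
        f (invFun (fun y : EuclideanSpace ℝ (Fin d) => y + (t * φ y) • v) x) =
      ∫ x in ball (0 : EuclideanSpace ℝ (Fin d)) R, (1 + t * fderiv ℝ φ x v) * f x := by
  set ψ := fun y : EuclideanSpace ℝ (Fin d) => y + (t * φ y) • v with hψ
  set B := ball (0 : EuclideanSpace ℝ (Fin d)) R
  set D := {x | DifferentiableAt ℝ φ x}
  have hbij : Bijective ψ := aux_bij hv hφ t ht
  have hD : MeasurableSet D := measurableSet_of_differentiableAt ℝ φ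
  have hDae : volume Dᶜ = 0 := hφ.ae_differentiableAt
  have hBD : (B ∩ D : Set _) =ᵐ[volume] B := by
    have : D =ᵐ[volume] (univ : Set _) := by
      rw [ae_eq_univ]; exact hDae
    simpa using (ae_eq_refl B).inter this
  have himg : (ψ '' (B ∩ D) : Set _) =ᵐ[volume] B := by
    have h1 : ψ '' B = B := aux_image hv hφ hφ0 t ht
    have h2 : ψ '' (B ∩ D) ⊆ B := by
      exact (image_mono inter_subset_left).trans h1.subset
    refine h2.eventuallyLE.antisymm ?_
    rw [ae_le_set]
    refine measure_mono_null ?_ (aux_null (aux_lip hv hφ t) hDae)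
    rintro y ⟨hy, hy'⟩
    rw [← h1] at hy
    obtain ⟨x, hx, rfl⟩ := hy
    exact ⟨x, fun hxD => hy' ⟨x, ⟨hx, hxD⟩, rfl⟩, rfl⟩
  have hder : ∀ x ∈ B ∩ D, HasFDerivWithinAt ψ
      (ContinuousLinearMap.id ℝ _ + (t • fderiv ℝ φ x).smulRight v) (B ∩ D) x := by
    intro x hx
    have h1 : HasFDerivAt φ (fderiv ℝ φ x) x := DifferentiableAt.hasFDerivAt hx.2
    exact ((hasFDerivAt_id x).add ((h1.const_mul t).smul_const v)).hasFDerivWithinAt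
  have hdet : ∀ x, (ContinuousLinearMap.id ℝ (EuclideanSpace ℝ (Fin d)) +
      (t • fderiv ℝ φ x).smulRight v).det = 1 + t * fderiv ℝ φ x v := by
    intro x
    have := LinearMap.transvection.det
      ((t • fderiv ℝ φ x : EuclideanSpace ℝ (Fin d) →L[ℝ] ℝ) :
        EuclideanSpace ℝ (Fin d) →ₗ[ℝ] ℝ) v
    exact this
  have hpos : ∀ x, 0 ≤ 1 + t * fderiv ℝ φ x v := by
    intro x
    have h1 : |fderiv ℝ φ x v| ≤ K := by
      have := (fderiv ℝ φ x).le_opNorm v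
      rw [hv, mul_one] at this
      exact this.trans (norm_fderiv_le_of_lipschitz ℝ hφ)
    have h2 : |t * fderiv ℝ φ x v| ≤ |t| * K := by
      rw [abs_mul]; exact mul_le_mul_of_nonneg_left h1 (abs_nonneg t)
    have := (abs_le.1 h2).1
    linarith
  rw [← setIntegral_congr_set himg,
    integral_image_eq_integral_abs_det_fderiv_smul volume (measurableSet_ball.inter hD) hder
      hbij.1.injOn, setIntegral_congr_set hBD]
  congr 1
  ext x
  rw [hdet, abs_of_nonneg (hpos x), leftInverse_invFun hbij.1 x, smul_eq_mul]

lemma aux_integrable (hφ : LipschitzWith K φ) (R : ℝ) (t : ℝ)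
    (f : EuclideanSpace ℝ (Fin d) → ℝ) (hf : Continuous f) :
    IntegrableOn (fun x => (1 + t * fderiv ℝ φ x v) * f x)
      (ball (0 : EuclideanSpace ℝ (Fin d)) R) := by
  have h1 : IntegrableOn f (ball (0 : EuclideanSpace ℝ (Fin d)) R) :=
    (hf.continuousOn.integrableOn_compact (isCompact_closedBall 0 R)).mono_set
      ball_subset_closedBall
  have hm : Measurable (fun x => 1 + t * fderiv ℝ φ x v) :=
    ((measurable_fderiv_apply_const ℝ φ v).const_mul t).const_add 1
  refine Integrable.bdd_mul (c := 1 + |t| * (K * ‖v‖)) h1 hm.aestronglyMeasurable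
    (Filter.Eventually.of_forall fun x => ?_)
  have h2 : ‖fderiv ℝ φ x v‖ ≤ K * ‖v‖ :=
    ((fderiv ℝ φ x).le_opNorm v).trans
      (mul_le_mul_of_nonneg_right (norm_fderiv_le_of_lipschitz ℝ hφ) (norm_nonneg v))
  refine (norm_add_le _ _).trans ?_
  rw [norm_one, norm_mul, Real.norm_eq_abs]
  gcongr

end helpers

/-- Let `d ≥ 1`, `R > 0`, `v` a unit vector and `φ : ℝ^d → ℝ` Lipschitz,
vanishing outside `B_R`. For `t` with `|t|·Lip(φ) < 1`, the map `ψ_t(x) = x + t·φ(x)·v` is a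
bi-Lipschitz bijection of `ℝ^d` mapping `B_R` onto `B_R`, and for every continuous `G : ℝ → ℝ`
and every continuous bounded `u : ℝ^d → ℝ`,
`∫_{B_R} G(u(ψ_t⁻¹(x))) dx + ∫_{B_R} G(u(ψ_{−t}⁻¹(x))) dx = 2 ∫_{B_R} G(u(x)) dx`. -/
theorem stmt8 (d : ℕ) (hd : 1 ≤ d) (R : ℝ) (hR : 0 < R)
    (v : EuclideanSpace ℝ (Fin d)) (hv : ‖v‖ = 1)
    (φ : EuclideanSpace ℝ (Fin d) → ℝ) (K : ℝ≥0) (hφ : LipschitzWith K φ)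
    (hφ0 : ∀ x ∉ ball (0 : EuclideanSpace ℝ (Fin d)) R, φ x = 0)
    (t : ℝ) (ht : |t| * (K : ℝ) < 1) :
    Function.Bijective (fun x : EuclideanSpace ℝ (Fin d) => x + (t * φ x) • v) ∧
    (∃ K' : ℝ≥0,
      LipschitzWith K' (fun x : EuclideanSpace ℝ (Fin d) => x + (t * φ x) • v) ∧
      LipschitzWith K'
        (invFun (fun x : EuclideanSpace ℝ (Fin d) => x + (t * φ x) • v))) ∧
    (fun x : EuclideanSpace ℝ (Fin d) => x + (t * φ x) • v) ''
        (ball (0 : EuclideanSpace ℝ (Fin d)) R) = ball (0 : EuclideanSpace ℝ (Fin d)) R ∧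
    ∀ G : ℝ → ℝ, Continuous G →
      ∀ u : EuclideanSpace ℝ (Fin d) → ℝ, Continuous u → (∃ M : ℝ, ∀ x, |u x| ≤ M) →
        (∫ x in ball (0 : EuclideanSpace ℝ (Fin d)) R,
            G (u (invFun (fun y : EuclideanSpace ℝ (Fin d) => y + (t * φ y) • v) x))) +
        (∫ x in ball (0 : EuclideanSpace ℝ (Fin d)) R,
            G (u (invFun (fun y : EuclideanSpace ℝ (Fin d) => y + (-t * φ y) • v) x))) =
        2 * ∫ x in ball (0 : EuclideanSpace ℝ (Fin d)) R, G (u x) := by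
  have ht' : |(-t)| * (K : ℝ) < 1 := by rwa [abs_neg]
  refine ⟨aux_bij hv hφ t ht, ?_, aux_image hv hφ hφ0 t ht, ?_⟩
  · refine ⟨max (Real.toNNReal (1 + |t| * K)) (Real.toNNReal (1 - |t| * K)⁻¹),
      (aux_lip hv hφ t).weaken (le_max_left _ _), ?_⟩
    exact ((aux_anti hv hφ t ht).to_rightInverse
      (rightInverse_invFun (aux_surj hv hφ t ht))).weaken (le_max_right _ _)
  · intro G hG u hu _
    rw [aux_int hv hφ hφ0 t ht (fun x => G (u x)), aux_int hv hφ hφ0 (-t) ht' (fun x => G (u x)),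
      ← integral_add (aux_integrable (v := v) hφ R t (fun x => G (u x)) (hG.comp hu))
        (aux_integrable (v := v) hφ R (-t) (fun x => G (u x)) (hG.comp hu)), ← integral_const_mul]
    congr 1
    ext x
    ring
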